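/- The restriction map from the group of σ-equivariant isometries O(Λ)^σ to O(Λ^σ) is surjective, where Λ = U³ ⊕ E8(-1)² ⊕ ⟨-2⟩ and σ swaps the two E8(-1) summands. -/

import Mathlib

/-- A Gram matrix of the `E8` root lattice (the Cartan matrix of `E8`):
even, unimodular, positive definite of rank `8`. -/
def gramE8 : Matrix (Fin 8) (Fin 8) ℤ :=
  !![ 2,-1, 0, 0, 0, 0, 0, 0;
     -1, 2,-1, 0, 0, 0, 0, 0;
      0,-1, 2,-1, 0, 0, 0,-1;
      0, 0,-1, 2,-1, 0, 0, 0;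
      0, 0, 0,-1, 2,-1, 0, 0;
      0, 0, 0, 0,-1, 2,-1, 0;
      0, 0, 0, 0, 0,-1, 2, 0;
      0, 0,-1, 0, 0, 0, 0, 2]

/-- The Gram matrix of `U³`, three copies of the hyperbolic plane. -/
def gramU3 : Matrix (Fin 6) (Fin 6) ℤ :=
  !![0,1,0,0,0,0; 1,0,0,0,0,0;
     0,0,0,1,0,0; 0,0,1,0,0,0;
     0,0,0,0,0,1; 0,0,0,0,1,0]

/-- The bilinear form of the `E8` lattice on `ℤ^8`. -/
noncomputable def bE8 : LinearMap.BilinForm ℤ (Fin 8 → ℤ) := Matrix.toBilin' gramE8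

/-- The bilinear form of `U³` on `ℤ^6`. -/
noncomputable def bU3 : LinearMap.BilinForm ℤ (Fin 6 → ℤ) := Matrix.toBilin' gramU3

/-- The underlying group of the lattice `Λ = U³ ⊕ E8(-1) ⊕ E8(-1) ⊕ ⟨-2⟩`
(the `K3^[2]` lattice). -/
abbrev LamK3 : Type := (Fin 6 → ℤ) × (Fin 8 → ℤ) × (Fin 8 → ℤ) × ℤ

noncomputable def bLamK3 : LinearMap.BilinForm ℤ LamK3 :=
  bU3.compl₁₂ (LinearMap.fst ℤ _ _) (LinearMap.fst ℤ _ _)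
  - bE8.compl₁₂ ((LinearMap.fst ℤ _ _).comp (LinearMap.snd ℤ _ _))
      ((LinearMap.fst ℤ _ _).comp (LinearMap.snd ℤ _ _))
  - bE8.compl₁₂
      ((LinearMap.fst ℤ _ _).comp ((LinearMap.snd ℤ _ _).comp (LinearMap.snd ℤ _ _)))
      ((LinearMap.fst ℤ _ _).comp ((LinearMap.snd ℤ _ _).comp (LinearMap.snd ℤ _ _)))
  - (2 : ℤ) • ((LinearMap.mul ℤ ℤ).compl₁₂
      ((LinearMap.snd ℤ _ _).comp ((LinearMap.snd ℤ _ _).comp (LinearMap.snd ℤ _ _)))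
      ((LinearMap.snd ℤ _ _).comp ((LinearMap.snd ℤ _ _).comp (LinearMap.snd ℤ _ _))))

/-- The involution `σ` of `Λ` swapping the two `E8(-1)` summands. -/
def sigmaK3 : LamK3 ≃ₗ[ℤ] LamK3 where
  toFun p := (p.1, p.2.2.1, p.2.1, p.2.2.2)
  invFun p := (p.1, p.2.2.1, p.2.1, p.2.2.2)
  map_add' _ _ := rfl
  map_smul' _ _ := rfl
  left_inv _ := rfl
  right_inv _ := rfl

/-- The invariant sublattice `Λ^σ = {v : σ v = v}`. -/
def FixK3 : Submodule ℤ LamK3 :=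
  LinearMap.ker (sigmaK3.toLinearMap - LinearMap.id)

/-- The underlying group of the lattice `T = U³ ⊕ E8(-2) ⊕ ⟨-2⟩`. -/
abbrev TK3 : Type := (Fin 6 → ℤ) × (Fin 8 → ℤ) × ℤ

/-- The bilinear form of `T = U³ ⊕ E8(-2) ⊕ ⟨-2⟩`. -/
noncomputable def bTK3 : LinearMap.BilinForm ℤ TK3 :=
  bU3.compl₁₂ (LinearMap.fst ℤ _ _) (LinearMap.fst ℤ _ _)
  - (2 : ℤ) • (bE8.compl₁₂ ((LinearMap.fst ℤ _ _).comp (LinearMap.snd ℤ _ _))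
      ((LinearMap.fst ℤ _ _).comp (LinearMap.snd ℤ _ _)))
  - (2 : ℤ) • ((LinearMap.mul ℤ ℤ).compl₁₂
      ((LinearMap.snd ℤ _ _).comp (LinearMap.snd ℤ _ _))
      ((LinearMap.snd ℤ _ _).comp (LinearMap.snd ℤ _ _)))

/-- The diagonal embedding `U³ ⊕ E8(-2) ⊕ ⟨-2⟩ → Λ`, `u ⊕ e ⊕ kδ ↦ u ⊕ e ⊕ e ⊕ kδ`. -/
def embDiag : TK3 →ₗ[ℤ] LamK3 where
  toFun p := (p.1, p.2.1, p.2.1, p.2.2)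
  map_add' _ _ := rfl
  map_smul' _ _ := rfl

/-- The positive roots of `E8`; the coefficient of the `i`-th simple root is the decimal digit
at `10 ^ i`. -/
def positiveRootCodes : List ℕ :=
  [1, 10, 100, 1000, 10000, 100000, 1000000, 10000000, 11, 110, 1100, 10000100, 11000, 110000,
   1100000, 111, 1110, 10000110, 11100, 10001100, 111000, 1110000, 1111, 10000111, 11110,
   10001110, 111100, 10011100, 1111000, 11111, 10001111, 111110, 10011110, 10001210, 1111100,
   10111100, 111111, 10011111, 10001211, 1111110, 10111110, 10011210, 11111100, 1111111, 10111111,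
   10011211, 10001221, 11111110, 10111210, 10012210, 11111111, 10111211, 10011221, 10012211,
   11111210, 10112210, 11111211, 10111221, 10112211, 10012221, 11112210, 10122210, 11111221,
   11112211, 10112221, 10122211, 10012321, 11122210, 11112221, 11122211, 10112321, 10122221,
   20012321, 11222210, 11112321, 11122221, 11222211, 10122321, 20112321, 11122321, 21112321,
   11222221, 10123321, 20122321, 11123321, 11222321, 21122321, 20123321, 11223321, 21123321,
   21222321, 20123421, 11233321, 21223321, 21123421, 20123431, 21233321, 21223421, 21123431,
   20123432, 21233421, 21223431, 21123432, 21233431, 21234421, 21223432, 21233432, 21234431,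
   21234432, 21234531, 21234532, 31234531, 21234542, 31234532, 31234542, 31234642, 31235642,
   31245642, 31345642, 32345642]

/-- The `i`-th decimal digit of `n`. -/
def digitAt (n i : ℕ) : ℕ := n / 10 ^ i % 10

theorem bE8_apply (x y : Fin 8 → ℤ) :
    bE8 x y = 2 * (x 0 * y 0 + x 1 * y 1 + x 2 * y 2 + x 3 * y 3 + x 4 * y 4 + x 5 * y 5
        + x 6 * y 6 + x 7 * y 7)
      - (x 0 * y 1 + x 1 * y 0 + x 1 * y 2 + x 2 * y 1 + x 2 * y 3 + x 3 * y 2 + x 3 * y 4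
        + x 4 * y 3 + x 4 * y 5 + x 5 * y 4 + x 5 * y 6 + x 6 * y 5 + x 2 * y 7 + x 7 * y 2) := by
  simp [bE8, Matrix.toBilin'_apply, Fin.sum_univ_eight, gramE8]
  ring

theorem bU3_apply (x y : Fin 6 → ℤ) :
    bU3 x y = x 0 * y 1 + x 1 * y 0 + x 2 * y 3 + x 3 * y 2 + x 4 * y 5 + x 5 * y 4 := by
  simp [bU3, Matrix.toBilin'_apply, Fin.sum_univ_six, gramU3]

theorem bE8_comm (x y : Fin 8 → ℤ) : bE8 x y = bE8 y x := by
  simp only [bE8_apply]; ring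

theorem two_dvd_bE8_self (x : Fin 8 → ℤ) : 2 ∣ bE8 x x := by
  rw [bE8_apply]; grind

theorem two_dvd_bU3_self (x : Fin 6 → ℤ) : 2 ∣ bU3 x x := by
  rw [bU3_apply]; grind

theorem bE8_self_pos {x : Fin 8 → ℤ} (hx : x ≠ 0) : 0 < bE8 x x := by
  by_contra! h
  have key : 840 * bE8 x x = 420 * (2 * x 0 - x 1) ^ 2 + 140 * (3 * x 1 - 2 * x 2) ^ 2
      + 70 * (4 * x 2 - 3 * x 3 - 3 * x 7) ^ 2 + 42 * (5 * x 3 - 4 * x 4 - 3 * x 7) ^ 2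
      + 28 * (6 * x 4 - 5 * x 5 - 3 * x 7) ^ 2 + 20 * (7 * x 5 - 6 * x 6 - 3 * x 7) ^ 2
      + 15 * (8 * x 6 - 3 * x 7) ^ 2 + 105 * x 7 ^ 2 := by
    rw [bE8_apply]; ring
  have p0 := sq_nonneg (2 * x 0 - x 1)
  have p1 := sq_nonneg (3 * x 1 - 2 * x 2)
  have p2 := sq_nonneg (4 * x 2 - 3 * x 3 - 3 * x 7)
  have p3 := sq_nonneg (5 * x 3 - 4 * x 4 - 3 * x 7)
  have p4 := sq_nonneg (6 * x 4 - 5 * x 5 - 3 * x 7)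
  have p5 := sq_nonneg (7 * x 5 - 6 * x 6 - 3 * x 7)
  have p6 := sq_nonneg (8 * x 6 - 3 * x 7)
  have p7 := sq_nonneg (x 7)
  have e7 : x 7 = 0 := (sq_nonpos_iff _).mp (by linarith)
  have e6 : 8 * x 6 - 3 * x 7 = 0 := (sq_nonpos_iff _).mp (by linarith)
  have e5 : 7 * x 5 - 6 * x 6 - 3 * x 7 = 0 := (sq_nonpos_iff _).mp (by linarith)
  have e4 : 6 * x 4 - 5 * x 5 - 3 * x 7 = 0 := (sq_nonpos_iff _).mp (by linarith)
  have e3 : 5 * x 3 - 4 * x 4 - 3 * x 7 = 0 := (sq_nonpos_iff _).mp (by linarith)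
  have e2 : 4 * x 2 - 3 * x 3 - 3 * x 7 = 0 := (sq_nonpos_iff _).mp (by linarith)
  have e1 : 3 * x 1 - 2 * x 2 = 0 := (sq_nonpos_iff _).mp (by linarith)
  have e0 : 2 * x 0 - x 1 = 0 := (sq_nonpos_iff _).mp (by linarith)
  refine hx (funext fun i => ?_)
  fin_cases i <;> simp only [Pi.zero_apply, Fin.reduceFinMk, Fin.zero_eta, Fin.mk_one] <;> omega

theorem bE8_self_of_mem_positiveRootCodes : ∀ n ∈ positiveRootCodes,
    digitAt n 0 ^ 2 + digitAt n 1 ^ 2 + digitAt n 2 ^ 2 + digitAt n 3 ^ 2 + digitAt n 4 ^ 2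
      + digitAt n 5 ^ 2 + digitAt n 6 ^ 2 + digitAt n 7 ^ 2
    = 1 + (digitAt n 0 * digitAt n 1 + digitAt n 1 * digitAt n 2 + digitAt n 2 * digitAt n 3
      + digitAt n 3 * digitAt n 4 + digitAt n 4 * digitAt n 5 + digitAt n 5 * digitAt n 6
      + digitAt n 2 * digitAt n 7) := by
  decide +kernel

/-- The code whose digits are the parities of the digits of the code `n`. -/
def parityCode (n : ℕ) : ℕ :=
  digitAt n 0 % 2 + 10 * (digitAt n 1 % 2) + 100 * (digitAt n 2 % 2) + 1000 * (digitAt n 3 % 2)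
    + 10000 * (digitAt n 4 % 2) + 100000 * (digitAt n 5 % 2) + 1000000 * (digitAt n 6 % 2)
    + 10000000 * (digitAt n 7 % 2)

theorem parityCode_mem_of_odd : ∀ a b c d e f g h : Fin 2,
    (a.val + b + c + d + e + f + g + h
      + (a * b + b * c + c * d + d * e + e * f + f * g + c * h : ℕ)) % 2 = 1 →
    (positiveRootCodes.any fun n => (parityCode n).beq (a + 10 * b + 100 * c + 1000 * d + 10000 * e
      + 100000 * f + 1000000 * g + 10000000 * h)) = true := by
  decide +kernel

theorem exists_positiveRootCode_mod_two (a b c d e f g h : Fin 2)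
    (hodd : (a.val + b + c + d + e + f + g + h
      + (a * b + b * c + c * d + d * e + e * f + f * g + c * h : ℕ)) % 2 = 1) :
    ∃ n ∈ positiveRootCodes, ∀ i : Fin 8, digitAt n i % 2 = ![a, b, c, d, e, f, g, h] i := by
  obtain ⟨n, hn, h⟩ := List.any_eq_true.mp (parityCode_mem_of_odd a b c d e f g h hodd)
  have h := Nat.eq_of_beq_eq_true h
  refine ⟨n, hn, fun i => ?_⟩
  rw [parityCode] at h
  fin_cases i <;> simp <;> omega

/-- Modulo two, the form of `E8` only depends on the classes of its arguments modulo two. -/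
theorem bE8_emod_two {x x' y y' : Fin 8 → ℤ} (hx : ∀ i, 2 ∣ x i - x' i)
    (hy : ∀ i, 2 ∣ y i - y' i) : 2 ∣ bE8 x y - bE8 x' y' := by
  choose u hu using hx
  choose v hv using hy
  have hx' : x = x' + (2 : ℤ) • u := funext fun i => by
    simp only [Pi.add_apply, Pi.smul_apply, smul_eq_mul]; linarith [hu i]
  have hy' : y = y' + (2 : ℤ) • v := funext fun i => by
    simp only [Pi.add_apply, Pi.smul_apply, smul_eq_mul]; linarith [hv i]
  refine ⟨bE8 x' v + bE8 u y' + 2 * bE8 u v, ?_⟩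
  rw [hx', hy']
  simp only [map_add, map_smul, LinearMap.add_apply, LinearMap.smul_apply, smul_eq_mul]
  ring

theorem bE8_self_emod_four {x x' : Fin 8 → ℤ} (hx : ∀ i, 2 ∣ x i - x' i) :
    4 ∣ bE8 x x - bE8 x' x' := by
  choose u hu using hx
  have hx' : x = x' + (2 : ℤ) • u := funext fun i => by
    simp only [Pi.add_apply, Pi.smul_apply, smul_eq_mul]; linarith [hu i]
  refine ⟨bE8 x' u + bE8 u u, ?_⟩
  rw [hx']
  simp only [map_add, map_smul, LinearMap.add_apply, LinearMap.smul_apply, smul_eq_mul,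
    bE8_comm u x']
  ring

/-- Every class of `E8 / 2 E8` with odd value of the quadratic form contains a root. -/
theorem exists_root_mod_two (x : Fin 8 → ℤ) (hx : ¬ 4 ∣ bE8 x x) :
    ∃ r : Fin 8 → ℤ, bE8 r r = 2 ∧ ∀ i, 2 ∣ x i - r i := by
  let m (i : Fin 8) : Fin 2 := ⟨(x i % 2).toNat, by omega⟩
  have hm (i : Fin 8) : 2 ∣ x i - ((m i : ℕ) : ℤ) := by simp only [m]; omega
  have hsq (i : Fin 8) : ((m i : ℕ) : ℤ) * (m i : ℕ) = (m i : ℕ) := by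
    generalize m i = c
    fin_cases c <;> rfl
  obtain ⟨n, hn, hdig⟩ := exists_positiveRootCode_mod_two
    (m 0) (m 1) (m 2) (m 3) (m 4) (m 5) (m 6) (m 7) (by
      by_contra hcon
      refine hx ((Int.dvd_iff_dvd_of_dvd_sub (bE8_self_emod_four hm)).mpr ?_)
      rw [bE8_apply]
      simp only [hsq]
      obtain ⟨c, hc⟩ := Nat.dvd_of_mod_eq_zero (Nat.mod_two_ne_one.mp hcon)
      zify at hc
      refine ⟨c - (m 0 * m 1 + m 1 * m 2 + m 2 * m 3 + m 3 * m 4 + m 4 * m 5 + m 5 * m 6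
        + m 2 * m 7 : ℕ), ?_⟩
      push_cast
      linarith)
  refine ⟨fun i => digitAt n i, ?_, fun i => ?_⟩
  · have := bE8_self_of_mem_positiveRootCodes n hn
    zify at this
    rw [bE8_apply]
    simp only [Fin.isValue, Fin.coe_ofNat_eq_mod]
    norm_num
    linarith
  · have : digitAt n i % 2 = m i := by rw [hdig]; fin_cases i <;> rfl
    have := hm i
    beta_reduce
    omega

/-- Vectors whose Gram matrix agrees up to signs with the Cartan matrix of `E8` can be rescaled
by signs to have that Gram matrix, the Dynkin diagram being a tree. -/
theorem exists_sign_bE8_eq_gramE8 (β : Fin 8 → Fin 8 → ℤ) (hβ : ∀ i, bE8 (β i) (β i) = 2)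
    (hB : ∀ i j, i ≠ j → bE8 (β i) (β j) = gramE8 i j ∨ bE8 (β i) (β j) = -gramE8 i j) :
    ∃ s : Fin 8 → ℤ, (∀ i, s i = 1 ∨ s i = -1) ∧
      ∀ i j, bE8 (s i • β i) (s j • β j) = gramE8 i j := by
  have e01 := hB 0 1 (by decide)
  have e12 := hB 1 2 (by decide)
  have e23 := hB 2 3 (by decide)
  have e34 := hB 3 4 (by decide)
  have e45 := hB 4 5 (by decide)
  have e56 := hB 5 6 (by decide)
  have e27 := hB 2 7 (by decide)
  simp only [show gramE8 0 1 = -1 from rfl, show gramE8 1 2 = -1 from rfl,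
    show gramE8 2 3 = -1 from rfl, show gramE8 3 4 = -1 from rfl, show gramE8 4 5 = -1 from rfl,
    show gramE8 5 6 = -1 from rfl, show gramE8 2 7 = -1 from rfl] at e01 e12 e23 e34 e45 e56 e27
  have next {s b : ℤ} (hs : s = 1 ∨ s = -1) (hb : b = -1 ∨ b = - -1) :
      ∃ t : ℤ, (t = 1 ∨ t = -1) ∧ s * t * b = -1 := by
    refine ⟨-(s * b), ?_⟩
    rcases hs with rfl | rfl <;> rcases hb with rfl | rfl <;> norm_num
  obtain ⟨s1, h1, f01⟩ := next (Or.inl rfl) e01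
  obtain ⟨s2, h2, f12⟩ := next h1 e12
  obtain ⟨s3, h3, f23⟩ := next h2 e23
  obtain ⟨s4, h4, f34⟩ := next h3 e34
  obtain ⟨s5, h5, f45⟩ := next h4 e45
  obtain ⟨s6, h6, f56⟩ := next h5 e56
  obtain ⟨s7, h7, f27⟩ := next h2 e27
  let s : Fin 8 → ℤ := ![1, s1, s2, s3, s4, s5, s6, s7]
  have hs (i : Fin 8) : s i = 1 ∨ s i = -1 := by
    fin_cases i
    exacts [Or.inl rfl, h1, h2, h3, h4, h5, h6, h7]
  refine ⟨s, hs, ?_⟩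
  have off (i j : Fin 8) (hij : i < j) : s i * s j * bE8 (β i) (β j) = gramE8 i j := by
    by_cases h0 : gramE8 i j = 0
    · have := hB i j hij.ne
      rw [h0, neg_zero, or_self] at this
      rw [this, h0, mul_zero]
    · have edges : ∀ p : Fin 8 × Fin 8, p.1 < p.2 → gramE8 p.1 p.2 ≠ 0 → p = (0, 1) ∨
          p = (1, 2) ∨ p = (2, 3) ∨ p = (3, 4) ∨ p = (4, 5) ∨ p = (5, 6) ∨ p = (2, 7) := by
        decide
      have h := edges (i, j) hij h0
      simp only [Prod.mk.injEq] at h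
      rcases h with ⟨rfl, rfl⟩ | ⟨rfl, rfl⟩ | ⟨rfl, rfl⟩ | ⟨rfl, rfl⟩ | ⟨rfl, rfl⟩ | ⟨rfl, rfl⟩ |
        ⟨rfl, rfl⟩
      exacts [f01, f12, f23, f34, f45, f56, f27]
  intro i j
  simp only [map_smul, LinearMap.smul_apply, smul_eq_mul]
  rcases lt_trichotomy i j with h | rfl | h
  · rw [← off i j h]; ring
  · have hdiag : ∀ i, gramE8 i i = 2 := by decide
    rw [hβ, hdiag]
    rcases hs i with h | h <;> rw [h] <;> norm_num
  · have hsymm : gramE8.transpose = gramE8 := by decide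
    rw [← hsymm, Matrix.transpose_apply, ← off j i h, bE8_comm]; ring

/-- Two roots that are incongruent modulo two have inner product `-1`, `0` or `1`. -/
theorem abs_bE8_le_one {r s : Fin 8 → ℤ} (hr : bE8 r r = 2) (hs : bE8 s s = 2)
    (hrs : ∃ i, ¬ 2 ∣ r i - s i) : -1 ≤ bE8 r s ∧ bE8 r s ≤ 1 := by
  obtain ⟨i, hi⟩ := hrs
  have hsub := bE8_self_pos (x := r - s) fun h => hi (by
    have := congrFun h i
    simp only [Pi.sub_apply, Pi.zero_apply] at this
    omega)
  have hadd := bE8_self_pos (x := r + s) fun h => hi (by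
    have := congrFun h i
    simp only [Pi.add_apply, Pi.zero_apply] at this
    omega)
  simp only [map_sub, map_add, LinearMap.sub_apply, LinearMap.add_apply, hr, hs,
    bE8_comm s r] at hsub hadd
  constructor <;> linarith

theorem bE8_single (i j : Fin 8) : bE8 (Pi.single i 1) (Pi.single j 1) = gramE8 i j :=
  Matrix.toBilin'_single gramE8 i j

theorem isUnit_gramE8 : IsUnit gramE8 :=
  IsUnit.of_mul_eq_one
    !![4, 7, 10, 8, 6, 4, 2, 5;
       7, 14, 20, 16, 12, 8, 4, 10;
       10, 20, 30, 24, 18, 12, 6, 15;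
       8, 16, 24, 20, 15, 10, 5, 12;
       6, 12, 18, 15, 12, 8, 4, 9;
       4, 8, 12, 10, 8, 6, 3, 6;
       2, 4, 6, 5, 4, 3, 2, 3;
       5, 10, 15, 12, 9, 6, 3, 8] (by decide +kernel)

/-- Vectors with Gram matrix `gramE8` are the images of the simple roots under an isometry. -/
theorem exists_isometry_of_gramE8 (γ : Fin 8 → Fin 8 → ℤ)
    (hγ : ∀ i j, bE8 (γ i) (γ j) = gramE8 i j) :
    ∃ ψ : (Fin 8 → ℤ) ≃ₗ[ℤ] (Fin 8 → ℤ), (∀ x y, bE8 (ψ x) (ψ y) = bE8 x y) ∧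
      ∀ i, ψ (Pi.single i 1) = γ i := by
  let M : Matrix (Fin 8) (Fin 8) ℤ := (Matrix.of γ).transpose
  have hM : M.transpose * gramE8 * M = gramE8 := by
    ext i j
    rw [← hγ i j, bE8, Matrix.toBilin'_apply', Matrix.mul_assoc]
    simp only [M, Matrix.mul_apply, Matrix.mulVec, dotProduct, Matrix.transpose_apply,
      Matrix.of_apply]
  have hdet : IsUnit M := by
    rw [Matrix.isUnit_iff_isUnit_det]
    have h := (Matrix.isUnit_iff_isUnit_det _).mp (hM.symm ▸ isUnit_gramE8 :
      IsUnit (M.transpose * gramE8 * M))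
    rw [Matrix.det_mul] at h
    exact isUnit_of_mul_isUnit_right h
  let ψ := LinearEquiv.ofBijective (Matrix.toLin' M) (by
    rw [← Module.End.isUnit_iff]
    exact hdet.map (Matrix.toLinAlgEquiv' : Matrix (Fin 8) (Fin 8) ℤ ≃ₐ[ℤ] _))
  refine ⟨ψ, fun x y => ?_, fun i => ?_⟩
  · change bE8 (Matrix.toLin' M x) (Matrix.toLin' M y) = bE8 x y
    rw [← LinearMap.BilinForm.comp_apply, bE8, Matrix.toBilin'_comp, hM]
  · change Matrix.toLin' M (Pi.single i 1) = γ i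
    rw [Matrix.toLin'_apply, Matrix.mulVec_single_one]
    rfl

/-- An endomorphism of `E8` preserving the quadratic form modulo two is congruent modulo two to
an isometry: the orthogonal group of `E8` surjects onto that of `E8 / 2 E8`. -/
theorem exists_isometry_mod_two (b : (Fin 8 → ℤ) →ₗ[ℤ] (Fin 8 → ℤ))
    (hq : ∀ e, 4 ∣ bE8 (b e) (b e) - bE8 e e) :
    ∃ ψ : (Fin 8 → ℤ) ≃ₗ[ℤ] (Fin 8 → ℤ), (∀ x y, bE8 (ψ x) (ψ y) = bE8 x y) ∧
      ∀ e i, 2 ∣ b e i - ψ e i := by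
  have hb (x y : Fin 8 → ℤ) : 2 ∣ bE8 (b x) (b y) - bE8 x y := by
    have h1 := hq (x + y)
    simp only [map_add, LinearMap.add_apply, bE8_comm (b y) (b x), bE8_comm y x] at h1
    have h2 := hq x
    have h3 := hq y
    omega
  have hdiag : ∀ i, gramE8 i i = 2 := by decide
  have hroot (i : Fin 8) := exists_root_mod_two (b (Pi.single i 1)) (by
    have := hq (Pi.single i 1)
    rw [bE8_single, hdiag] at this
    omega)
  choose β hβ hβb using hroot
  have hmod (i j : Fin 8) : 2 ∣ bE8 (β i) (β j) - gramE8 i j := by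
    have h1 := bE8_emod_two (hβb i) (hβb j)
    have h2 := hb (Pi.single i 1) (Pi.single j 1)
    rw [bE8_single] at h2
    omega
  obtain ⟨s, hs, hsβ⟩ := exists_sign_bE8_eq_gramE8 β hβ fun i j hij => by
    have hrow : ∀ i j, i ≠ j → ∃ k, ¬ 2 ∣ gramE8 i k - gramE8 j k := by decide
    obtain ⟨k, hk⟩ := hrow i j hij
    obtain ⟨h1, h2⟩ := abs_bE8_le_one (hβ i) (hβ j) (by
      by_contra! hcon
      have h1 := bE8_emod_two hcon (y := β k) (y' := β k) (by simp)
      have h2 := hmod i k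
      have h3 := hmod j k
      omega)
    have hent : ∀ p : Fin 8 × Fin 8, p.1 ≠ p.2 → gramE8 p.1 p.2 = 0 ∨ gramE8 p.1 p.2 = -1 := by
      decide
    have h3 := hmod i j
    rcases hent (i, j) hij with h | h <;> simp only [h] at h3 ⊢ <;> omega
  obtain ⟨ψ, hψ, hψs⟩ := exists_isometry_of_gramE8 _ hsβ
  refine ⟨ψ, hψ, fun e i => ?_⟩
  rw [pi_eq_sum_univ' e]
  simp only [map_sum, map_smul, hψs, Finset.sum_apply, Pi.smul_apply, smul_eq_mul,
    ← Finset.sum_sub_distrib, ← mul_sub]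
  refine Finset.dvd_sum fun j _ => Dvd.dvd.mul_left ?_ _
  have h := hβb j i
  rcases hs j with h' | h' <;> rw [h'] <;> omega

theorem bTK3_apply (s t : TK3) :
    bTK3 s t = bU3 s.1 t.1 - 2 * bE8 s.2.1 t.2.1 - 2 * (s.2.2 * t.2.2) := rfl

theorem bLamK3_apply (x y : LamK3) :
    bLamK3 x y = bU3 x.1 y.1 - bE8 x.2.1 y.2.1 - bE8 x.2.2.1 y.2.2.1
      - 2 * (x.2.2.2 * y.2.2.2) := rfl

/-- An isometry of `T` maps `E8(-2)` into the vectors with even `U³`- and `⟨-2⟩`-components, and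
its `E8(-2)`-component preserves the quadratic form modulo two. -/
theorem even_components_of_isometry (φ : TK3 ≃ₗ[ℤ] TK3)
    (hφ : ∀ s t : TK3, bTK3 (φ s) (φ t) = bTK3 s t) (e : Fin 8 → ℤ) :
    (∀ i, 2 ∣ (φ (0, e, 0)).1 i) ∧ 2 ∣ (φ (0, e, 0)).2.2 ∧
      4 ∣ bE8 (φ (0, e, 0)).2.1 (φ (0, e, 0)).2.1 - bE8 e e := by
  have heven (u : Fin 6 → ℤ) : 2 ∣ bU3 (φ (0, e, 0)).1 u := by
    have h := hφ (0, e, 0) (φ.symm (u, 0, 0))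
    rw [φ.apply_symm_apply, bTK3_apply, bTK3_apply] at h
    simp only [map_zero, LinearMap.zero_apply] at h
    omega
  have hu (i : Fin 6) : 2 ∣ (φ (0, e, 0)).1 i := by
    have h0 := heven (Pi.single 0 1)
    have h1 := heven (Pi.single 1 1)
    have h2 := heven (Pi.single 2 1)
    have h3 := heven (Pi.single 3 1)
    have h4 := heven (Pi.single 4 1)
    have h5 := heven (Pi.single 5 1)
    simp [bU3_apply] at h0 h1 h2 h3 h4 h5
    fin_cases i <;> assumption
  have hself := hφ (0, e, 0) (0, e, 0)
  rw [bTK3_apply, bTK3_apply] at hself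
  simp only [map_zero] at hself
  have h8 : 8 ∣ bU3 (φ (0, e, 0)).1 (φ (0, e, 0)).1 := by
    choose a ha using hu
    have ha' : (φ (0, e, 0)).1 = (2 : ℤ) • a := funext ha
    rw [ha']
    simp only [map_smul, LinearMap.smul_apply, smul_eq_mul]
    have := two_dvd_bU3_self a
    omega
  have hb := two_dvd_bE8_self (φ (0, e, 0)).2.1
  have he := two_dvd_bE8_self e
  have hc : 2 ∣ (φ (0, e, 0)).2.2 := by
    have : 2 ∣ (φ (0, e, 0)).2.2 * (φ (0, e, 0)).2.2 := by omega
    exact (Int.prime_two.dvd_or_dvd this).elim id id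
  refine ⟨hu, hc, ?_⟩
  obtain ⟨c, hc⟩ := hc
  have : 4 ∣ (φ (0, e, 0)).2.2 * (φ (0, e, 0)).2.2 := ⟨c * c, by rw [hc]; ring⟩
  omega

/-- The antidiagonal embedding `E8(-2) → Λ`. -/
def embAnti : (Fin 8 → ℤ) →ₗ[ℤ] LamK3 where
  toFun e := (0, e, -e, 0)
  map_add' x y := by simp [add_comm]
  map_smul' c x := by simp

/-- Twice the projection of `Λ` to `Λ^σ ⊗ ℚ`. -/
def invPart : LamK3 →ₗ[ℤ] TK3 where
  toFun x := ((2 : ℤ) • x.1, x.2.1 + x.2.2.1, (2 : ℤ) • x.2.2.2)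
  map_add' x y := by ext <;> simp <;> ring
  map_smul' c x := by ext <;> simp <;> ring

/-- Twice the projection of `Λ` to `Λ_σ ⊗ ℚ`. -/
def antiPart : LamK3 →ₗ[ℤ] (Fin 8 → ℤ) where
  toFun x := x.2.1 - x.2.2.1
  map_add' x y := by ext; simp; ring
  map_smul' c x := by ext; simp; ring

theorem bLamK3_embDiag_add_embAnti (s t : TK3) (d e : Fin 8 → ℤ) :
    bLamK3 (embDiag s + embAnti d) (embDiag t + embAnti e) = bTK3 s t - 2 * bE8 d e := by
  rw [bLamK3_apply, bTK3_apply]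
  simp [embDiag, embAnti]
  ring

theorem embDiag_invPart_add_embAnti_antiPart (x : LamK3) :
    embDiag (invPart x) + embAnti (antiPart x) = (2 : ℤ) • x := by
  ext <;> simp [embDiag, embAnti, invPart, antiPart] <;> ring

theorem invPart_embDiag_add_embAnti (t : TK3) (d : Fin 8 → ℤ) :
    invPart (embDiag t + embAnti d) = (2 : ℤ) • t := by
  ext <;> simp [embDiag, embAnti, invPart]; ring

theorem antiPart_embDiag_add_embAnti (t : TK3) (d : Fin 8 → ℤ) :
    antiPart (embDiag t + embAnti d) = (2 : ℤ) • d := by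
  ext; simp [embDiag, embAnti, antiPart]
  ring

/-- Gluing: a pair of endomorphisms of `Λ^σ` and `Λ_σ` that agree on the discriminant groups
extends to `Λ`. -/
theorem exists_glue (φ : TK3 →ₗ[ℤ] TK3) (ψ : (Fin 8 → ℤ) →ₗ[ℤ] (Fin 8 → ℤ))
    (h : ∀ e, ∃ t, φ (0, e, 0) = (0, ψ e, 0) + (2 : ℤ) • t) :
    ∃ Φ : LamK3 →ₗ[ℤ] LamK3,
      ∀ x, (2 : ℤ) • Φ x = embDiag (φ (invPart x)) + embAnti (ψ (antiPart x)) := by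
  have hdiv (x : LamK3) :
      ∃ y, (2 : ℤ) • y = embDiag (φ (invPart x)) + embAnti (ψ (antiPart x)) := by
    obtain ⟨t, ht⟩ := h (x.2.1 + x.2.2.1)
    refine ⟨embDiag (φ (x.1, 0, x.2.2.2)) + embDiag t + (0, ψ x.2.1, ψ x.2.2.1, 0), ?_⟩
    have hx : invPart x = (2 : ℤ) • (x.1, 0, x.2.2.2) + (0, x.2.1 + x.2.2.1, 0) := by
      simp [invPart]
    rw [hx, map_add, map_smul, ht]
    simp only [map_add, map_smul, antiPart, LinearMap.coe_mk, AddHom.coe_mk, map_sub]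
    ext <;> simp [embDiag, embAnti] <;> ring
  choose f hf using hdiv
  have hinj : Function.Injective fun y : LamK3 => (2 : ℤ) • y :=
    smul_right_injective _ two_ne_zero
  exact ⟨{ toFun := f
           map_add' := fun x y => hinj (by simp only [smul_add, hf, map_add]; abel)
           map_smul' := fun c x => hinj (by
            simp only [RingHom.id_apply, smul_comm (2 : ℤ) c, hf, map_smul, smul_add]) }, hf⟩

/-- **Surjectivity of `O(Λ)^σ → O(Λ^σ)`.**  For `Λ = U³ ⊕ E8(-1)² ⊕ ⟨-2⟩` with the
involution `σ` swapping the two `E8(-1)` summands, every isometry `φ` of the invariant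
lattice `Λ^σ ≅ U³ ⊕ E8(-2) ⊕ ⟨-2⟩` (embedded diagonally) is the restriction of a
`σ`-equivariant isometry `Φ` of `Λ`, i.e. the restriction map
`O(Λ)^σ → O(Λ^σ)` is surjective. -/
theorem equivariant_restriction_surjective :
    ∀ φ : TK3 ≃ₗ[ℤ] TK3, (∀ s t : TK3, bTK3 (φ s) (φ t) = bTK3 s t) →
      ∃ Φ : LamK3 ≃ₗ[ℤ] LamK3,
        (∀ x y : LamK3, bLamK3 (Φ x) (Φ y) = bLamK3 x y)
        ∧ (∀ v : LamK3, Φ (sigmaK3 v) = sigmaK3 (Φ v))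
        ∧ (∀ t : TK3, Φ (embDiag t) = embDiag (φ t)) := by
  intro φ hφ
  obtain ⟨ψ, hψ, hψφ⟩ := exists_isometry_mod_two
    (LinearMap.fst ℤ _ _ ∘ₗ LinearMap.snd ℤ _ _ ∘ₗ φ.toLinearMap ∘ₗ
      LinearMap.inr ℤ (Fin 6 → ℤ) _ ∘ₗ LinearMap.inl ℤ (Fin 8 → ℤ) ℤ)
    fun e => (even_components_of_isometry φ hφ e).2.2
  have hglue (e : Fin 8 → ℤ) : ∃ t, φ (0, e, 0) = (0, ψ e, 0) + (2 : ℤ) • t := by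
    obtain ⟨ha, ⟨c, hc⟩, -⟩ := even_components_of_isometry φ hφ e
    choose a ha using ha
    choose b hb using hψφ e
    refine ⟨(a, b, c), Prod.ext (funext fun i => ?_) (Prod.ext (funext fun i => ?_) ?_)⟩
    · simpa using ha i
    · have := hb i
      simp only [LinearMap.comp_apply, LinearMap.inl_apply, LinearMap.inr_apply,
        LinearMap.fst_apply, LinearMap.snd_apply, LinearEquiv.coe_coe] at this
      simp only [Prod.snd_add, Prod.fst_add, Prod.smul_mk, Pi.add_apply, Pi.smul_apply,
        smul_eq_mul]
      linarith
    · simpa using hc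
  have hglue' (e : Fin 8 → ℤ) : ∃ t, φ.symm (0, e, 0) = (0, ψ.symm e, 0) + (2 : ℤ) • t := by
    obtain ⟨t, ht⟩ := hglue (ψ.symm e)
    refine ⟨-φ.symm t, ?_⟩
    rw [ψ.apply_symm_apply, ← sub_eq_iff_eq_add] at ht
    rw [← ht, map_sub, map_smul, φ.symm_apply_apply]
    module
  obtain ⟨Φ, hΦ⟩ := exists_glue φ ψ hglue
  obtain ⟨Ψ, hΨ⟩ := exists_glue φ.symm ψ.symm hglue'
  simp only [LinearEquiv.coe_coe] at hΦ hΨ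
  have hinj : Function.Injective fun y : LamK3 => (2 : ℤ) • y :=
    smul_right_injective _ two_ne_zero
  have hΨΦ (x : LamK3) : Ψ (Φ x) = x := hinj (hinj (by
    beta_reduce
    rw [← map_smul, hΦ, hΨ, invPart_embDiag_add_embAnti, antiPart_embDiag_add_embAnti]
    simp only [map_smul, LinearEquiv.symm_apply_apply]
    rw [← smul_add, embDiag_invPart_add_embAnti_antiPart]))
  have hΦΨ (x : LamK3) : Φ (Ψ x) = x := hinj (hinj (by
    beta_reduce
    rw [← map_smul, hΨ, hΦ, invPart_embDiag_add_embAnti, antiPart_embDiag_add_embAnti]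
    simp only [map_smul, LinearEquiv.apply_symm_apply]
    rw [← smul_add, embDiag_invPart_add_embAnti_antiPart]))
  refine ⟨LinearEquiv.ofLinearMap Φ Ψ (LinearMap.ext hΦΨ) (LinearMap.ext hΨΦ), fun x y => ?_,
    fun v => hinj ?_, fun t => hinj ?_⟩
  · have h4 : (2 : ℤ) * (2 * bLamK3 (Φ x) (Φ y)) = 2 * (2 * bLamK3 x y) := by
      calc (2 : ℤ) * (2 * bLamK3 (Φ x) (Φ y))
          = bLamK3 ((2 : ℤ) • Φ x) ((2 : ℤ) • Φ y) := by
            simp only [map_smul, LinearMap.smul_apply, smul_eq_mul]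
        _ = bLamK3 ((2 : ℤ) • x) ((2 : ℤ) • y) := by
            rw [hΦ, hΦ, bLamK3_embDiag_add_embAnti, hφ, hψ, ← bLamK3_embDiag_add_embAnti,
              embDiag_invPart_add_embAnti_antiPart, embDiag_invPart_add_embAnti_antiPart]
        _ = 2 * (2 * bLamK3 x y) := by
            simp only [map_smul, LinearMap.smul_apply, smul_eq_mul]
    change bLamK3 (Φ x) (Φ y) = bLamK3 x y
    linarith
  · change (2 : ℤ) • Φ (sigmaK3 v) = (2 : ℤ) • sigmaK3 (Φ v)
    have hinv : invPart (sigmaK3 v) = invPart v := by simp [invPart, sigmaK3, add_comm]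
    have hanti : antiPart (sigmaK3 v) = -antiPart v := by simp [antiPart, sigmaK3]
    rw [hΦ, ← map_smul sigmaK3, hΦ, hinv, hanti, map_neg]
    ext <;> simp [sigmaK3, embDiag, embAnti]
  · change (2 : ℤ) • Φ (embDiag t) = (2 : ℤ) • embDiag (φ t)
    have hinv := invPart_embDiag_add_embAnti t 0
    have hanti := antiPart_embDiag_add_embAnti t 0
    rw [map_zero, add_zero] at hinv hanti
    rw [hΦ, hinv, hanti, smul_zero, map_zero, map_zero, add_zero, map_smul, map_smul]
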